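/- arXiv:2003.09252 — 2 statements merged into one kernel-verified Lean document; each statement's English description precedes it below -/
import Mathlib

section
/- Let the strong stability hypotheses hold: there exists ε0 > 0 such that for every r ∈ B(τ, ε0) ∩ (ℝ⁺)^m and every λ ∈ ℂ with Re λ ≥ 0 the matrices λE − A0 − Σ_{i=1}^m A_i e^{−λr_i} and Uᵀ A0 V + Σ_{i=1}^m Uᵀ A_i V e^{−λr_i} are invertible, and the supremum over such λ and r of ‖(Uᵀ A0 V + Σ_{i=1}^m Uᵀ A_i V e^{−λr_i})^{−1}‖ is finite. Then for every γ > 0 there exist ε > 0 and Ω > 0 such that σ1(T(jω, r) − T_a(jω, r)) < γ for all ω > Ω and all r ∈ B(τ, ε) ∩ (ℝ⁺)^m. -/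
open Matrix

/-- largest singular value (= L2 operator norm) of a complex matrix. -/
noncomputable def sigma1 {p q : ℕ} (M : Matrix (Fin p) (Fin q) ℂ) : ℝ :=
  ‖LinearMap.toContinuousLinearMap (Matrix.toEuclideanLin M)‖

/-- characteristic matrix λE − A0 − Σ_i A_i e^{−λ r_i}. -/
noncomputable def Delta {n m : ℕ} (E A0 : Matrix (Fin n) (Fin n) ℝ)
    (A : Fin m → Matrix (Fin n) (Fin n) ℝ) (r : Fin m → ℝ) (lam : ℂ) :
    Matrix (Fin n) (Fin n) ℂ :=
  lam • E.map Complex.ofReal - A0.map Complex.ofReal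
    - ∑ i, Complex.exp (-lam * (r i : ℂ)) • (A i).map Complex.ofReal

/-- transfer function T(λ, r) = C (λE − A0 − Σ A_i e^{−λ r_i})⁻¹ B. -/
noncomputable def Ttf {n m n_w n_z : ℕ} (E A0 : Matrix (Fin n) (Fin n) ℝ)
    (A : Fin m → Matrix (Fin n) (Fin n) ℝ)
    (B : Matrix (Fin n) (Fin n_w) ℝ) (C : Matrix (Fin n_z) (Fin n) ℝ)
    (r : Fin m → ℝ) (lam : ℂ) : Matrix (Fin n_z) (Fin n_w) ℂ :=
  C.map Complex.ofReal * (Delta E A0 A r lam)⁻¹ * B.map Complex.ofReal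

/-- Uᵀ A0 V + Σ_i Uᵀ A_i V e^{−λ r_i}. -/
noncomputable def DeltaA {n m ν : ℕ} (A0 : Matrix (Fin n) (Fin n) ℝ)
    (A : Fin m → Matrix (Fin n) (Fin n) ℝ)
    (U V : Matrix (Fin n) (Fin ν) ℝ) (r : Fin m → ℝ) (lam : ℂ) :
    Matrix (Fin ν) (Fin ν) ℂ :=
  (Uᵀ * A0 * V).map Complex.ofReal
    + ∑ i, Complex.exp (-lam * (r i : ℂ)) • (Uᵀ * A i * V).map Complex.ofReal

/-- asymptotic transfer function T_a(λ, r) = −CV (Uᵀ A0 V + Σ Uᵀ A_i V e^{−λ r_i})⁻¹ Uᵀ B. -/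
noncomputable def Ta {n m ν n_w n_z : ℕ} (A0 : Matrix (Fin n) (Fin n) ℝ)
    (A : Fin m → Matrix (Fin n) (Fin n) ℝ)
    (B : Matrix (Fin n) (Fin n_w) ℝ) (C : Matrix (Fin n_z) (Fin n) ℝ)
    (U V : Matrix (Fin n) (Fin ν) ℝ) (r : Fin m → ℝ) (lam : ℂ) :
    Matrix (Fin n_z) (Fin n_w) ℂ :=
  -((C * V).map Complex.ofReal * (DeltaA A0 A U V r lam)⁻¹ * (Uᵀ * B).map Complex.ofReal)

/-- Uᵀ A0 V + Σ_i Uᵀ A_i V e^{−jθ_i}. -/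
noncomputable def ABar {n m ν : ℕ} (A0 : Matrix (Fin n) (Fin n) ℝ)
    (A : Fin m → Matrix (Fin n) (Fin n) ℝ)
    (U V : Matrix (Fin n) (Fin ν) ℝ) (θ : Fin m → ℝ) :
    Matrix (Fin ν) (Fin ν) ℂ :=
  (Uᵀ * A0 * V).map Complex.ofReal
    + ∑ i, Complex.exp (-Complex.I * (θ i : ℂ)) • (Uᵀ * A i * V).map Complex.ofReal

/-- 𝕋_a(θ) = −CV (Uᵀ A0 V + Σ Uᵀ A_i V e^{−jθ_i})⁻¹ Uᵀ B. -/
noncomputable def TaBar {n m ν n_w n_z : ℕ} (A0 : Matrix (Fin n) (Fin n) ℝ)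
    (A : Fin m → Matrix (Fin n) (Fin n) ℝ)
    (B : Matrix (Fin n) (Fin n_w) ℝ) (C : Matrix (Fin n_z) (Fin n) ℝ)
    (U V : Matrix (Fin n) (Fin ν) ℝ) (θ : Fin m → ℝ) :
    Matrix (Fin n_z) (Fin n_w) ℂ :=
  -((C * V).map Complex.ofReal * (ABar A0 A U V θ)⁻¹ * (Uᵀ * B).map Complex.ofReal)

/-- strong H∞-type value: lim_{ε→0+} (i.e. inf over ε > 0, by monotonicity) of
    sup { H r : r in the open Euclidean ball B(τ, ε) with all components positive }. -/
noncomputable def strongVal {m : ℕ} (H : (Fin m → ℝ) → ℝ) (τ : Fin m → ℝ) : ℝ :=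
  ⨅ ε : {e : ℝ // 0 < e},
    sSup {x : ℝ | ∃ r : Fin m → ℝ,
      (∑ i, (r i - τ i) ^ 2) < (ε : ℝ) ^ 2 ∧ (∀ i, 0 < r i) ∧ x = H r}

/-- ξ is a singular value of M: ξ ≥ 0 and ξ² is an eigenvalue of MᴴM. -/
def IsSingularValue {p q : ℕ} (M : Matrix (Fin p) (Fin q) ℂ) (ξ : ℝ) : Prop :=
  0 ≤ ξ ∧ ∃ v : Fin q → ℂ, v ≠ 0 ∧ (Mᴴ * M) *ᵥ v = ((ξ : ℂ) ^ 2) • v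

/-- strong stability hypotheses: on some ball of positive delay vectors around τ,
    the characteristic matrices are invertible in the closed right half plane and
    the inverse of the asymptotic characteristic matrix is uniformly bounded there. -/
def StrongHyp {n m ν : ℕ} (E A0 : Matrix (Fin n) (Fin n) ℝ)
    (A : Fin m → Matrix (Fin n) (Fin n) ℝ)
    (U V : Matrix (Fin n) (Fin ν) ℝ) (τ : Fin m → ℝ) : Prop :=
  ∃ ε0 : ℝ, 0 < ε0 ∧
    (∀ r : Fin m → ℝ, (∑ i, (r i - τ i) ^ 2) < ε0 ^ 2 → (∀ i, 0 < r i) →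
      ∀ lam : ℂ, 0 ≤ lam.re →
        IsUnit (Delta E A0 A r lam) ∧ IsUnit (DeltaA A0 A U V r lam)) ∧
    ∃ Mb : ℝ, ∀ r : Fin m → ℝ, (∑ i, (r i - τ i) ^ 2) < ε0 ^ 2 → (∀ i, 0 < r i) →
      ∀ lam : ℂ, 0 ≤ lam.re → sigma1 ((DeltaA A0 A U V r lam)⁻¹) ≤ Mb

section Helpers
open scoped Matrix.Norms.L2Operator

theorem aux_decomp {n ν : ℕ} (E : Matrix (Fin n) (Fin n) ℝ) (U : Matrix (Fin n) (Fin ν) ℝ)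
    (hν : ν = n - E.rank) (hU : U.rank = ν) (hUE : Uᵀ * E = 0) :
    ∃ (G : Matrix (Fin n) (Fin n) ℝ) (H : Matrix (Fin n) (Fin ν) ℝ), 1 = E * G + H * Uᵀ := by
  have hunit : IsUnit (Uᵀ * U) := by
    rw [← Matrix.mulVec_surjective_iff_isUnit]
    have h0 : Module.finrank ℝ (LinearMap.range (Uᵀ * U).mulVecLin) = ν := by
      have := Matrix.rank_transpose_mul_self U
      rw [hU] at this
      exact this
    have h1 : LinearMap.range (Uᵀ * U).mulVecLin = ⊤ := by
      apply Submodule.eq_top_of_finrank_eq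
      rw [h0]; simp
    exact LinearMap.range_eq_top.1 h1
  have hdet : IsUnit (Uᵀ * U).det := (Matrix.isUnit_iff_isUnit_det _).1 hunit
  have hker : LinearMap.range E.mulVecLin = LinearMap.ker (Uᵀ).mulVecLin := by
    apply Submodule.eq_of_le_of_finrank_eq
    · rintro _ ⟨x, rfl⟩
      rw [LinearMap.mem_ker, Matrix.mulVecLin_apply, Matrix.mulVecLin_apply,
        Matrix.mulVec_mulVec, hUE, Matrix.zero_mulVec]
    · have h1 := LinearMap.finrank_range_add_finrank_ker (Uᵀ).mulVecLin
      have h2 : Module.finrank ℝ (LinearMap.range (Uᵀ).mulVecLin) = ν := by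
        have := Matrix.rank_transpose U
        rw [hU] at this
        exact this
      have h3 : Module.finrank ℝ (LinearMap.range E.mulVecLin) = E.rank := rfl
      have h4 : E.rank ≤ n := by simpa using E.rank_le_width
      rw [h2] at h1
      simp at h1
      rw [h3]
      omega
  set H : Matrix (Fin n) (Fin ν) ℝ := U * (Uᵀ * U)⁻¹ with hH
  have hUH : Uᵀ * H = 1 := by
    rw [hH, ← Matrix.mul_assoc, Matrix.mul_nonsing_inv _ hdet]
  have hz : Uᵀ * (1 - H * Uᵀ) = 0 := by
    rw [Matrix.mul_sub, ← Matrix.mul_assoc, hUH]; simp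
  have hcol : ∀ j, ∃ g : Fin n → ℝ, E *ᵥ g = (1 - H * Uᵀ).col j := by
    intro j
    have : (1 - H * Uᵀ).col j ∈ LinearMap.ker (Uᵀ).mulVecLin := by
      rw [LinearMap.mem_ker, Matrix.mulVecLin_apply, ← Matrix.mulVec_single_one,
        Matrix.mulVec_mulVec, hz, Matrix.zero_mulVec]
    rw [← hker] at this
    exact this
  choose g hg using hcol
  refine ⟨(Matrix.of g)ᵀ, H, ?_⟩
  have : E * (Matrix.of g)ᵀ = 1 - H * Uᵀ := by
    ext i j
    have := congrFun (hg j) i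
    simpa [Matrix.mul_apply, Matrix.mulVec, dotProduct] using this
  rw [this]; simp

theorem aux_core {n ν : ℕ} (E Q G : Matrix (Fin n) (Fin n) ℂ) (H V : Matrix (Fin n) (Fin ν) ℂ)
    (Ut : Matrix (Fin ν) (Fin n) ℂ) (lam : ℂ) (hlam : lam ≠ 0)
    (h1 : 1 = E * G + H * Ut) (hEV : E * V = 0)
    (hD : IsUnit (Ut * Q * V)) (hΔ : IsUnit (lam • E - Q)) (Z : Matrix (Fin n) (Fin n) ℂ)
    (hZ : Z = (lam • E - Q)⁻¹ + V * (Ut * Q * V)⁻¹ * Ut) :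
    lam • Z = (1 + (Z - V * (Ut * Q * V)⁻¹ * Ut) * Q) * G * (1 - Q * (V * (Ut * Q * V)⁻¹ * Ut)) := by
  have hDd : IsUnit (Ut * Q * V).det := (Matrix.isUnit_iff_isUnit_det _).1 hD
  have hΔd : IsUnit (lam • E - Q).det := (Matrix.isUnit_iff_isUnit_det _).1 hΔ
  set X := (lam • E - Q)⁻¹ with hX
  set W := V * (Ut * Q * V)⁻¹ * Ut with hW
  have hXZ : Z - W = X := by rw [hZ]; simp
  have hXD : X * (lam • E - Q) = 1 := Matrix.nonsing_inv_mul _ hΔd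
  have hEW : E * W = 0 := by
    rw [hW, ← Matrix.mul_assoc, ← Matrix.mul_assoc, hEV]; simp
  have hUP : Ut * (1 - Q * W) = 0 := by
    have : Ut * (Q * W) = Ut := by
      have : Ut * (Q * W) = (Ut * Q * V) * (Ut * Q * V)⁻¹ * Ut := by
        rw [hW]; simp only [Matrix.mul_assoc]
      rw [this, Matrix.mul_nonsing_inv _ hDd, Matrix.one_mul]
    rw [Matrix.mul_sub, this]; simp
  have hP : E * (G * (1 - Q * W)) = 1 - Q * W := by
    have : (1 : Matrix (Fin n) (Fin n) ℂ) * (1 - Q * W) = (E * G + H * Ut) * (1 - Q * W) := by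
      rw [← h1]
    rw [Matrix.one_mul, Matrix.add_mul, Matrix.mul_assoc H, hUP, Matrix.mul_zero, add_zero,
      Matrix.mul_assoc] at this
    exact this.symm
  have hXE : 1 + X * Q = lam • (X * E) := by
    rw [Matrix.mul_sub, Matrix.mul_smul] at hXD
    rw [← hXD]; simp
  have hZP : Z = X * (1 - Q * W) := by
    have h2 : X * (lam • E - Q) * W = W := by rw [hXD, Matrix.one_mul]
    rw [Matrix.mul_assoc, Matrix.sub_mul, Matrix.smul_mul, hEW, smul_zero, zero_sub] at h2
    rw [sub_eq_add_neg, Matrix.mul_add, h2, Matrix.mul_one, hZ]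
  rw [hXZ, hXE, Matrix.smul_mul, Matrix.smul_mul, Matrix.mul_assoc, Matrix.mul_assoc, hP, ← hZP]

theorem aux_norm_mul {l m n : ℕ} (M : Matrix (Fin l) (Fin m) ℂ) (N : Matrix (Fin m) (Fin n) ℂ)
    {a b : ℝ} (ha : ‖M‖ ≤ a) (hb : ‖N‖ ≤ b) : ‖M * N‖ ≤ a * b :=
  (Matrix.l2_opNorm_mul M N).trans
    (mul_le_mul ha hb (norm_nonneg _) ((norm_nonneg _).trans ha))

theorem aux_bound {n ν : ℕ} (E Q G : Matrix (Fin n) (Fin n) ℂ) (H V : Matrix (Fin n) (Fin ν) ℂ)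
    (Ut : Matrix (Fin ν) (Fin n) ℂ) (lam : ℂ) (hlam : lam ≠ 0)
    (h1 : 1 = E * G + H * Ut) (hEV : E * V = 0)
    (hD : IsUnit (Ut * Q * V)) (hΔ : IsUnit (lam • E - Q)) (K M : ℝ)
    (hQ : ‖Q‖ ≤ K) (hM : ‖(Ut * Q * V)⁻¹‖ ≤ M) :
    ‖lam‖ * ‖(lam • E - Q)⁻¹ + V * (Ut * Q * V)⁻¹ * Ut‖ ≤
      (‖(1 : Matrix (Fin n) (Fin n) ℂ)‖ +
        (‖(lam • E - Q)⁻¹ + V * (Ut * Q * V)⁻¹ * Ut‖ + ‖V‖ * M * ‖Ut‖) * K) * ‖G‖ *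
        (‖(1 : Matrix (Fin n) (Fin n) ℂ)‖ + K * (‖V‖ * M * ‖Ut‖)) := by
  have hc := aux_core E Q G H V Ut lam hlam h1 hEV hD hΔ _ rfl
  have hW : ‖V * (Ut * Q * V)⁻¹ * Ut‖ ≤ ‖V‖ * M * ‖Ut‖ :=
    aux_norm_mul _ _ (aux_norm_mul _ _ le_rfl hM) le_rfl
  rw [← norm_smul, hc]
  refine aux_norm_mul _ _ (aux_norm_mul _ _ ?_ le_rfl) ?_
  · refine (norm_add_le _ _).trans (add_le_add le_rfl (aux_norm_mul _ _ ?_ hQ))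
    exact (norm_sub_le _ _).trans (add_le_add le_rfl hW)
  · exact (norm_sub_le _ _).trans (add_le_add le_rfl (aux_norm_mul _ _ hQ hW))

theorem aux_sigma {p q : ℕ} (M : Matrix (Fin p) (Fin q) ℂ) : sigma1 M = ‖M‖ := rfl

theorem aux_map_mul {l m n : ℕ} (M : Matrix (Fin l) (Fin m) ℝ) (N : Matrix (Fin m) (Fin n) ℝ) :
    (M * N).map Complex.ofReal = M.map Complex.ofReal * N.map Complex.ofReal :=
  Matrix.map_mul (f := Complex.ofRealHom)

theorem aux_main (n m n_w n_z ν : ℕ)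
    (E A0 : Matrix (Fin n) (Fin n) ℝ) (A : Fin m → Matrix (Fin n) (Fin n) ℝ)
    (B : Matrix (Fin n) (Fin n_w) ℝ) (C : Matrix (Fin n_z) (Fin n) ℝ)
    (U V : Matrix (Fin n) (Fin ν) ℝ)
    (hν : ν = n - E.rank) (hU : U.rank = ν)
    (hUE : Uᵀ * E = 0) (hEV : E * V = 0)
    (τ : Fin m → ℝ)
    (hstrong : StrongHyp E A0 A U V τ) :
    ∀ γ : ℝ, 0 < γ → ∃ ε : ℝ, 0 < ε ∧ ∃ Ω : ℝ, 0 < Ω ∧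
      ∀ ω : ℝ, Ω < ω → ∀ r : Fin m → ℝ,
        (∑ i, (r i - τ i) ^ 2) < ε ^ 2 → (∀ i, 0 < r i) →
          sigma1 (Ttf E A0 A B C r (Complex.I * (ω : ℂ))
            - Ta A0 A B C U V r (Complex.I * (ω : ℂ))) < γ := by
  intro γ hγ
  obtain ⟨ε0, hε0, hinv, Mb0, hMb0⟩ := hstrong
  obtain ⟨G, H, hGH⟩ := aux_decomp E U hν hU hUE
  obtain ⟨Mb, hMbpos, hMbge⟩ : ∃ Mb : ℝ, 0 ≤ Mb ∧ Mb0 ≤ Mb :=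
    ⟨max 0 Mb0, le_max_left _ _, le_max_right _ _⟩
  obtain ⟨K, hK⟩ : ∃ x : ℝ, x = ‖A0.map Complex.ofReal‖ + ∑ i, ‖(A i).map Complex.ofReal‖ := ⟨_, rfl⟩
  have hK0 : 0 ≤ K := hK ▸ add_nonneg (norm_nonneg _) (Finset.sum_nonneg fun i _ => norm_nonneg _)
  obtain ⟨N1, hN1⟩ : ∃ x : ℝ, x = ‖(1 : Matrix (Fin n) (Fin n) ℂ)‖ := ⟨_, rfl⟩
  have hN10 : 0 ≤ N1 := hN1 ▸ norm_nonneg _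
  obtain ⟨w, hw⟩ : ∃ x : ℝ, x = ‖V.map Complex.ofReal‖ * Mb * ‖Uᵀ.map Complex.ofReal‖ := ⟨_, rfl⟩
  have hw0 : 0 ≤ w := hw ▸ mul_nonneg (mul_nonneg (norm_nonneg _) hMbpos) (norm_nonneg _)
  obtain ⟨c, hc⟩ : ∃ x : ℝ, x = ‖G.map Complex.ofReal‖ * (N1 + K * w) := ⟨_, rfl⟩
  have hc0 : 0 ≤ c := hc ▸ mul_nonneg (norm_nonneg _) (add_nonneg hN10 (mul_nonneg hK0 hw0))
  obtain ⟨a, ha⟩ : ∃ x : ℝ, x = (N1 + w * K) * c := ⟨_, rfl⟩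
  have ha0 : 0 ≤ a := by rw [ha]; positivity
  obtain ⟨b, hb⟩ : ∃ x : ℝ, x = K * c := ⟨_, rfl⟩
  have hb0 : 0 ≤ b := by rw [hb]; positivity
  obtain ⟨d, hd⟩ : ∃ x : ℝ, x = ‖C.map Complex.ofReal‖ * ‖B.map Complex.ofReal‖ := ⟨_, rfl⟩
  have hd0 : 0 ≤ d := hd ▸ mul_nonneg (norm_nonneg _) (norm_nonneg _)
  refine ⟨ε0, hε0, 1 + b + a * d / γ, by positivity, ?_⟩
  intro ω hω r hr hrpos
  have hω0 : 0 < ω := lt_trans (by positivity) hω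
  set lam : ℂ := Complex.I * (ω : ℂ) with hlam
  have hre : lam.re = 0 := by simp [hlam]
  have hnorm : ‖lam‖ = ω := by simp [hlam, abs_of_pos hω0]
  have hlam0 : lam ≠ 0 := by
    rw [← norm_pos_iff, hnorm]; exact hω0
  obtain ⟨hΔ, hD⟩ := hinv r hr hrpos lam hre.ge
  have hM := (hMb0 r hr hrpos lam hre.ge).trans hMbge
  rw [aux_sigma] at hM
  set Q : Matrix (Fin n) (Fin n) ℂ := A0.map Complex.ofReal
    + ∑ i, Complex.exp (-lam * (r i : ℂ)) • (A i).map Complex.ofReal with hQ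
  have hΔQ : Delta E A0 A r lam = lam • E.map Complex.ofReal - Q := by
    rw [hQ, Delta, sub_sub]
  have hDQ : DeltaA A0 A U V r lam = Uᵀ.map Complex.ofReal * Q * V.map Complex.ofReal := by
    rw [hQ, DeltaA]
    simp only [aux_map_mul, Matrix.mul_add, Matrix.add_mul, Matrix.mul_sum, Matrix.sum_mul,
      Matrix.mul_smul, Matrix.smul_mul]
  have hQK : ‖Q‖ ≤ K := by
    rw [hQ, hK]
    refine (norm_add_le _ _).trans (add_le_add le_rfl ?_)
    refine (norm_sum_le _ _).trans (Finset.sum_le_sum fun i _ => ?_)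
    rw [norm_smul, Complex.norm_exp]
    have : (-lam * (r i : ℂ)).re = 0 := by simp [hlam]
    rw [this]; simp
  have h1 : (1 : Matrix (Fin n) (Fin n) ℂ) = E.map Complex.ofReal * G.map Complex.ofReal
      + H.map Complex.ofReal * Uᵀ.map Complex.ofReal := by
    rw [← aux_map_mul, ← aux_map_mul, ← Matrix.map_add _ Complex.ofReal_add, ← hGH]
    simp
  have hEV' : E.map Complex.ofReal * V.map Complex.ofReal = 0 := by
    rw [← aux_map_mul, hEV]; simp
  rw [hΔQ] at hΔ
  rw [hDQ] at hD hM
  have hB := aux_bound _ Q _ _ _ _ lam hlam0 h1 hEV' hD hΔ K Mb hQK hM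
  rw [hnorm, ← hN1, ← hw] at hB
  have hT : Ttf E A0 A B C r lam - Ta A0 A B C U V r lam = C.map Complex.ofReal *
      ((lam • E.map Complex.ofReal - Q)⁻¹ + V.map Complex.ofReal *
        (Uᵀ.map Complex.ofReal * Q * V.map Complex.ofReal)⁻¹ * Uᵀ.map Complex.ofReal) *
      B.map Complex.ofReal := by
    rw [Ttf, Ta, hΔQ, hDQ, sub_neg_eq_add]
    simp only [aux_map_mul, Matrix.mul_add, Matrix.add_mul, Matrix.mul_assoc]
  rw [aux_sigma, hT]
  set Z := (lam • E.map Complex.ofReal - Q)⁻¹ + V.map Complex.ofReal *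
        (Uᵀ.map Complex.ofReal * Q * V.map Complex.ofReal)⁻¹ * Uᵀ.map Complex.ofReal with hZ
  have hle := aux_norm_mul _ (B.map Complex.ofReal)
    (aux_norm_mul (C.map Complex.ofReal) Z le_rfl le_rfl) le_rfl
  refine lt_of_le_of_lt hle ?_
  have hB2 : (ω - b) * ‖Z‖ ≤ a := by
    have : (N1 + (‖Z‖ + w) * K) * ‖G.map Complex.ofReal‖ * (N1 + K * w) = a + ‖Z‖ * b := by
      rw [ha, hb, hc]; ring
    have h5 := hB.trans this.le
    linarith
  have hB3 : (ω - b) * (‖Z‖ * d) ≤ a * d := by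
    rw [← mul_assoc]; exact mul_le_mul_of_nonneg_right hB2 hd0
  have hB4 : a * d + γ < (ω - b) * γ := by
    have : (1 + a * d / γ) * γ < (ω - b) * γ := mul_lt_mul_of_pos_right (by linarith) hγ
    rw [add_mul, div_mul_cancel₀ _ hγ.ne'] at this
    linarith
  have hpos : 0 < ω - b := by
    have : 0 ≤ a * d / γ := by positivity
    linarith
  have hfin : ‖Z‖ * d < γ := by
    refine lt_of_mul_lt_mul_left ?_ hpos.le
    linarith
  calc _ = ‖Z‖ * d := by rw [hd]; ring
    _ < γ := hfin

end Helpers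

theorem stmt8 (n m n_w n_z ν : ℕ)
    (E A0 : Matrix (Fin n) (Fin n) ℝ) (A : Fin m → Matrix (Fin n) (Fin n) ℝ)
    (B : Matrix (Fin n) (Fin n_w) ℝ) (C : Matrix (Fin n_z) (Fin n) ℝ)
    (U V : Matrix (Fin n) (Fin ν) ℝ)
    (hν : ν = n - E.rank) (hU : U.rank = ν) (hV : V.rank = ν)
    (hUE : Uᵀ * E = 0) (hEV : E * V = 0)
    (τ : Fin m → ℝ) (hτ : ∀ i, 0 < τ i)
    (hstrong : StrongHyp E A0 A U V τ) :
    ∀ γ : ℝ, 0 < γ → ∃ ε : ℝ, 0 < ε ∧ ∃ Ω : ℝ, 0 < Ω ∧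
      ∀ ω : ℝ, Ω < ω → ∀ r : Fin m → ℝ,
        (∑ i, (r i - τ i) ^ 2) < ε ^ 2 → (∀ i, 0 < r i) →
          sigma1 (Ttf E A0 A B C r (Complex.I * (ω : ℂ))
            - Ta A0 A B C U V r (Complex.I * (ω : ℂ))) < γ := by
  exact aux_main n m n_w n_z ν E A0 A B C U V hν hU hUE hEV τ hstrong
end

section
/- Assume the matrix Uᵀ A0 V + Σ_{i=1}^m Uᵀ A_i V e^{−jθ_i} is invertible for every θ = (θ1,...,θm) ∈ [0, 2π]^m. Then the strong H∞ norm of the asymptotic transfer function is independent of the delay values: for any two delay vectors τ, τ′ ∈ (ℝ⁺₀)^m, ⦀T_a(j·, τ)⦀∞ = ⦀T_a(j·, τ′)⦀∞. -/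
open Matrix

lemma aux_exp (x y p : ℝ) (k : ℤ) (w : ℝ) (hw : w * p = 2 * Real.pi) (h : w * x - w * y = k * (w * p)) :
    Complex.exp (-Complex.I * ((w * x : ℝ) : ℂ)) = Complex.exp (-Complex.I * ((w * y : ℝ) : ℂ)) := by
  rw [Complex.exp_eq_exp_iff_exists_int]
  refine ⟨-k, ?_⟩
  have : w * x = w * y + k * (2 * Real.pi) := by rw [← hw]; linarith
  rw [this]
  push_cast
  ring

lemma aux_cont {p q : ℕ} : Continuous (sigma1 : Matrix (Fin p) (Fin q) ℂ → ℝ) := by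
  have h : Continuous (fun M : Matrix (Fin p) (Fin q) ℂ =>
      LinearMap.toContinuousLinearMap (Matrix.toEuclideanLin M)) :=
    LinearMap.continuous_of_finiteDimensional
      ((LinearMap.toContinuousLinearMap.toLinearMap).comp
        (Matrix.toEuclideanLin (𝕜 := ℂ) (m := Fin p) (n := Fin q)).toLinearMap)
  exact h.norm

lemma aux_ABar_cont {n m ν : ℕ} (A0 : Matrix (Fin n) (Fin n) ℝ)
    (A : Fin m → Matrix (Fin n) (Fin n) ℝ)
    (U V : Matrix (Fin n) (Fin ν) ℝ) : Continuous (ABar A0 A U V) := by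
  unfold ABar
  fun_prop

lemma aux_ABar_congr {n m ν : ℕ} (A0 : Matrix (Fin n) (Fin n) ℝ)
    (A : Fin m → Matrix (Fin n) (Fin n) ℝ)
    (U V : Matrix (Fin n) (Fin ν) ℝ) (θ θ' : Fin m → ℝ)
    (h : ∀ i, Complex.exp (-Complex.I * (θ i : ℂ)) = Complex.exp (-Complex.I * (θ' i : ℂ))) :
    ABar A0 A U V θ = ABar A0 A U V θ' := by
  simp only [ABar, h]

lemma aux_bdd {n m ν n_w n_z : ℕ} (A0 : Matrix (Fin n) (Fin n) ℝ)
    (A : Fin m → Matrix (Fin n) (Fin n) ℝ)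
    (B : Matrix (Fin n) (Fin n_w) ℝ) (C : Matrix (Fin n_z) (Fin n) ℝ)
    (U V : Matrix (Fin n) (Fin ν) ℝ)
    (hθ : ∀ θ : Fin m → ℝ, (∀ i, θ i ∈ Set.Icc (0 : ℝ) (2 * Real.pi)) →
      IsUnit (ABar A0 A U V θ)) :
    BddAbove (Set.range fun θ => sigma1 (TaBar A0 A B C U V θ)) := by
  have hK : IsCompact (Set.pi Set.univ (fun _ : Fin m => Set.Icc (0 : ℝ) (2 * Real.pi))) :=
    isCompact_univ_pi fun _ => isCompact_Icc
  have hAc := aux_ABar_cont A0 A U V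
  have hinv : ContinuousOn (fun θ => (ABar A0 A U V θ)⁻¹)
      (Set.pi Set.univ (fun _ : Fin m => Set.Icc (0 : ℝ) (2 * Real.pi))) := by
    simp only [Matrix.inv_def, Ring.inverse_eq_inv']
    suffices h : ContinuousOn (fun θ => (ABar A0 A U V θ).det⁻¹)
        (Set.pi Set.univ (fun _ : Fin m => Set.Icc (0 : ℝ) (2 * Real.pi))) from
      h.smul hAc.matrix_adjugate.continuousOn
    refine hAc.matrix_det.continuousOn.inv₀ ?_
    intro θ h
    exact ((Matrix.isUnit_iff_isUnit_det _).1 (hθ θ fun i => h i trivial)).ne_zero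
  have hc : ContinuousOn (fun θ => sigma1 (TaBar A0 A B C U V θ))
      (Set.pi Set.univ (fun _ : Fin m => Set.Icc (0 : ℝ) (2 * Real.pi))) := by
    refine aux_cont.comp_continuousOn ?_
    unfold TaBar
    have h2 : Continuous (fun M : Matrix (Fin ν) (Fin ν) ℂ =>
      -((C * V).map Complex.ofReal * M * (Uᵀ * B).map Complex.ofReal)) := by fun_prop
    exact h2.comp_continuousOn hinv
  obtain ⟨M, hM⟩ := hK.bddAbove_image hc
  refine ⟨M, ?_⟩
  rintro _ ⟨θ, rfl⟩
  have hp := Real.two_pi_pos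
  have : TaBar A0 A B C U V θ = TaBar A0 A B C U V (fun i => toIcoMod hp 0 (θ i)) := by
    unfold TaBar
    rw [aux_ABar_congr A0 A U V θ (fun i => toIcoMod hp 0 (θ i))]
    intro i
    have := aux_exp (θ i) (toIcoMod hp 0 (θ i)) (2 * Real.pi) (toIcoDiv hp 0 (θ i)) 1 (by ring) (by
      have := self_sub_toIcoMod hp 0 (θ i)
      rw [zsmul_eq_mul] at this
      linarith)
    simpa using this
  simp only [this]
  refine hM ⟨_, ?_, rfl⟩
  intro i _
  have := toIcoMod_mem_Ico hp 0 (θ i)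
  exact ⟨this.1, by have := this.2; linarith⟩

lemma aux_Ta {n m ν n_w n_z : ℕ} (A0 : Matrix (Fin n) (Fin n) ℝ)
    (A : Fin m → Matrix (Fin n) (Fin n) ℝ)
    (B : Matrix (Fin n) (Fin n_w) ℝ) (C : Matrix (Fin n_z) (Fin n) ℝ)
    (U V : Matrix (Fin n) (Fin ν) ℝ) (r : Fin m → ℝ) (ω : ℝ) :
    Ta A0 A B C U V r (Complex.I * (ω : ℂ)) = TaBar A0 A B C U V (fun i => ω * r i) := by
  unfold Ta TaBar DeltaA ABar
  simp only [Complex.ofReal_mul, neg_mul, mul_assoc]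

lemma aux_val {n m ν n_w n_z : ℕ} (A0 : Matrix (Fin n) (Fin n) ℝ)
    (A : Fin m → Matrix (Fin n) (Fin n) ℝ)
    (B : Matrix (Fin n) (Fin n_w) ℝ) (C : Matrix (Fin n_z) (Fin n) ℝ)
    (U V : Matrix (Fin n) (Fin ν) ℝ)
    (hb : BddAbove (Set.range fun θ => sigma1 (TaBar A0 A B C U V θ)))
    (τ : Fin m → ℝ) (hτ : ∀ i, 0 < τ i) :
    strongVal (fun r => ⨆ ω : ℝ, sigma1 (Ta A0 A B C U V r (Complex.I * (ω : ℂ)))) τ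
      = ⨆ θ, sigma1 (TaBar A0 A B C U V θ) := by
  simp only [aux_Ta]
  have hbr : ∀ r : Fin m → ℝ,
      BddAbove (Set.range fun ω : ℝ => sigma1 (TaBar A0 A B C U V (fun i => ω * r i))) := by
    intro r
    refine hb.mono ?_
    rintro _ ⟨ω, rfl⟩
    exact ⟨_, rfl⟩
  have hle : ∀ r : Fin m → ℝ, (⨆ ω : ℝ, sigma1 (TaBar A0 A B C U V (fun i => ω * r i)))
      ≤ ⨆ θ, sigma1 (TaBar A0 A B C U V θ) :=
    fun r => ciSup_le fun ω => le_ciSup hb _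
  haveI : Nonempty {e : ℝ // 0 < e} := ⟨⟨1, one_pos⟩⟩
  unfold strongVal
  rw [← ciInf_const (ι := {e : ℝ // 0 < e}) (a := ⨆ θ, sigma1 (TaBar A0 A B C U V θ))]
  congr 1
  funext ⟨ε, hε⟩
  apply le_antisymm
  · refine csSup_le ⟨_, τ, by simpa using pow_pos hε 2, hτ, rfl⟩ ?_
    rintro x ⟨r, -, -, rfl⟩
    exact hle r
  · refine ciSup_le fun θ => ?_
    have hm : (0 : ℝ) < m + 1 := by positivity
    obtain ⟨p, hp, hpe⟩ : ∃ p : ℝ, 0 < p ∧ p * (m + 1) = ε :=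
      ⟨ε / (m + 1), by positivity, by field_simp⟩
    obtain ⟨w, hw, hwp⟩ : ∃ w : ℝ, 0 < w ∧ w * p = 2 * Real.pi :=
      ⟨2 * Real.pi / p, by positivity, by field_simp⟩
    set r : Fin m → ℝ := fun i => toIcoMod hp (τ i) (θ i / w) with hr
    have hmem : ∀ i, r i ∈ Set.Ico (τ i) (τ i + p) := fun i => toIcoMod_mem_Ico hp _ _
    have heq : TaBar A0 A B C U V θ = TaBar A0 A B C U V (fun i => w * r i) := by
      unfold TaBar
      rw [aux_ABar_congr A0 A U V θ (fun i => w * r i)]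
      intro i
      have := aux_exp (θ i / w) (r i) p (toIcoDiv hp (τ i) (θ i / w)) w hwp (by
        have := self_sub_toIcoMod hp (τ i) (θ i / w)
        rw [zsmul_eq_mul] at this
        rw [← mul_sub, hr]
        simp only
        rw [this]; ring)
      rwa [mul_div_cancel₀ _ hw.ne'] at this
    rw [heq]
    refine (le_ciSup (hbr r) w).trans (le_csSup ?_ ⟨r, ?_, ?_, rfl⟩)
    · refine ⟨⨆ θ, sigma1 (TaBar A0 A B C U V θ), ?_⟩
      rintro x ⟨r, -, -, rfl⟩
      exact hle r
    · calc ∑ i, (r i - τ i) ^ 2 ≤ ∑ _i : Fin m, p ^ 2 := by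
            refine Finset.sum_le_sum fun i _ => ?_
            have h1 := (hmem i).1
            have h2 := (hmem i).2
            exact pow_le_pow_left₀ (by linarith) (by linarith) 2
        _ = m * p ^ 2 := by simp
        _ < ε ^ 2 := by
            rw [← hpe, mul_pow, mul_comm]
            have : (0 : ℝ) ≤ m := Nat.cast_nonneg m
            exact mul_lt_mul_of_pos_left (by nlinarith) (by positivity)
    · intro i
      exact (hτ i).trans_le (hmem i).1

theorem stmt14 (n m n_w n_z ν : ℕ)
    (E A0 : Matrix (Fin n) (Fin n) ℝ) (A : Fin m → Matrix (Fin n) (Fin n) ℝ)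
    (B : Matrix (Fin n) (Fin n_w) ℝ) (C : Matrix (Fin n_z) (Fin n) ℝ)
    (U V : Matrix (Fin n) (Fin ν) ℝ)
    (hν : ν = n - E.rank) (hU : U.rank = ν) (hV : V.rank = ν)
    (hUE : Uᵀ * E = 0) (hEV : E * V = 0)
    (hθ : ∀ θ : Fin m → ℝ, (∀ i, θ i ∈ Set.Icc (0 : ℝ) (2 * Real.pi)) →
      IsUnit (ABar A0 A U V θ)) :
    ∀ τ τ' : Fin m → ℝ, (∀ i, 0 < τ i) → (∀ i, 0 < τ' i) →
      strongVal (fun r => ⨆ ω : ℝ, sigma1 (Ta A0 A B C U V r (Complex.I * (ω : ℂ)))) τ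
        = strongVal (fun r => ⨆ ω : ℝ, sigma1 (Ta A0 A B C U V r (Complex.I * (ω : ℂ)))) τ' := by
  intro τ τ' h h'
  have hb := aux_bdd A0 A B C U V hθ
  rw [aux_val A0 A B C U V hb τ h, aux_val A0 A B C U V hb τ' h']
end
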